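/- arXiv:1508.02851 — 5 statements merged into one kernel-verified Lean document; each statement's English description precedes it below -/
import Mathlib

section
/- If G is a bipartite simple graph with at least one edge that admits a bipartition (X,Y) with min{|X|, |Y|} ≤ 3, then G is interval colorable. -/
/-- A proper edge-coloring of `G` with colors `1,…,t` is an *interval `t`-coloring* if
all colors `1,…,t` are used, the colors of edges incident to each vertex are distinct
(i.e. the coloring is proper), and form an interval of consecutive integers. -/
def IsIntervalColoring {V : Type*} (G : SimpleGraph V) (t : ℕ) (c : G.edgeSet → ℕ) : Prop :=
  (∀ e, 1 ≤ c e ∧ c e ≤ t) ∧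
  (∀ e₁ e₂ : G.edgeSet, e₁ ≠ e₂ → (∃ v, v ∈ (e₁ : Sym2 V) ∧ v ∈ (e₂ : Sym2 V)) →
      c e₁ ≠ c e₂) ∧
  (∀ k, 1 ≤ k → k ≤ t → ∃ e, c e = k) ∧
  (∀ v : V, ∀ k₁ k₂ k : ℕ,
    (∃ e₁ : G.edgeSet, v ∈ (e₁ : Sym2 V) ∧ c e₁ = k₁) →
    (∃ e₂ : G.edgeSet, v ∈ (e₂ : Sym2 V) ∧ c e₂ = k₂) →
    k₁ ≤ k → k ≤ k₂ →
    ∃ e : G.edgeSet, v ∈ (e : Sym2 V) ∧ c e = k)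

/-- `G` is *interval colorable* if it has an interval `t`-coloring for some `t ≥ 1`. -/
def IntervalColorable {V : Type*} (G : SimpleGraph V) : Prop :=
  ∃ t : ℕ, 0 < t ∧ ∃ c : G.edgeSet → ℕ, IsIntervalColoring G t c

/-- `(X, Y)` is a bipartition of the graph `G`. -/
def IsBipartition {V : Type*} (G : SimpleGraph V) (X Y : Set V) : Prop :=
  Disjoint X Y ∧ X ∪ Y = Set.univ ∧
    ∀ u v : V, G.Adj u v → (u ∈ X ∧ v ∈ Y) ∨ (u ∈ Y ∧ v ∈ X)

/-- `G` is bipartite. -/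
def IsBipartite {V : Type*} (G : SimpleGraph V) : Prop :=
  ∃ X Y : Set V, IsBipartition G X Y

/-- An integer edge-coloring that is injective with order-connected image at every vertex
can be compressed to an interval coloring. -/
theorem intervalColorable_of_int_coloring {V : Type*} [Fintype V] {G : SimpleGraph V}
    (hedge : G.edgeSet.Nonempty) (c : G.edgeSet → ℤ)
    (hinj : ∀ v : V, Set.InjOn c {e | v ∈ (e : Sym2 V)})
    (hconn : ∀ v : V, (c '' {e | v ∈ (e : Sym2 V)}).OrdConnected) :
    IntervalColorable G := by
  classical
  have : Fintype G.edgeSet := Fintype.ofFinite _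
  obtain ⟨e₀, he₀⟩ := hedge
  set s : Finset ℤ := Finset.univ.image c with hs
  have hmem (e : G.edgeSet) : c e ∈ s := by simp [hs]
  let r : s ≃o Fin s.card := (s.orderIsoOfFin rfl).symm
  refine ⟨s.card, Finset.card_pos.2 ⟨_, hmem ⟨e₀, he₀⟩⟩,
    fun e => (r ⟨c e, hmem e⟩ : ℕ) + 1, ?_, ?_, ?_, ?_⟩
  · intro e
    have := (r ⟨c e, hmem e⟩).isLt
    dsimp only
    omega
  · rintro e₁ e₂ hne ⟨v, h₁, h₂⟩ h
    refine hne (hinj v h₁ h₂ ?_)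
    have h' : r ⟨c e₁, hmem e₁⟩ = r ⟨c e₂, hmem e₂⟩ := Fin.ext (by simpa using h)
    simpa using r.injective h'
  · intro k hk hkt
    obtain ⟨⟨z, hz⟩, hrz⟩ := r.surjective ⟨k - 1, by omega⟩
    obtain ⟨e, -, rfl⟩ := Finset.mem_image.1 hz
    refine ⟨e, ?_⟩
    have : (r ⟨c e, hmem e⟩ : ℕ) = k - 1 := by rw [hrz]
    dsimp only
    omega
  · rintro v k₁ k₂ k ⟨e₁, hv₁, h₁⟩ ⟨e₂, hv₂, h₂⟩ hk₁ hk₂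
    dsimp only at h₁ h₂
    have hlt := (r ⟨c e₂, hmem e₂⟩).isLt
    obtain ⟨⟨z, hz⟩, hrz⟩ := r.surjective ⟨k - 1, by omega⟩
    have hle₁ : r ⟨c e₁, hmem e₁⟩ ≤ r ⟨z, hz⟩ := by
      rw [hrz, Fin.le_def]; dsimp only; omega
    have hle₂ : r ⟨z, hz⟩ ≤ r ⟨c e₂, hmem e₂⟩ := by
      rw [hrz, Fin.le_def]; dsimp only; omega
    have hz₁ : c e₁ ≤ z := r.le_iff_le.1 hle₁
    have hz₂ : z ≤ c e₂ := r.le_iff_le.1 hle₂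
    obtain ⟨e, hve, rfl⟩ := (hconn v).out ⟨e₁, hv₁, rfl⟩ ⟨e₂, hv₂, rfl⟩ ⟨hz₁, hz₂⟩
    refine ⟨e, hve, ?_⟩
    have : (r ⟨c e, hmem e⟩ : ℕ) = k - 1 := by rw [hrz]
    dsimp only
    omega

/-- Let `N y` be the neighborhood of `y` in `ι`. The edges between `S` and `ι` can be labelled
by integers so that the labels at each `y ∈ S` form an interval, and those at each `i : ι` form
the interval `[a i, b i)`. -/
def IntervalLabelled {V ι : Type*} (N : V → Set ι) (a : ι → ℤ) (S : Set V) (b : ι → ℤ) : Prop :=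
  a ≤ b ∧ ∃ φ : V → ι → ℤ, (∀ y ∈ S, ∃ l u, Set.BijOn (φ y) (N y) (Set.Ico l u)) ∧
    ∀ i, Set.BijOn (fun y => φ y i) {y ∈ S | i ∈ N y} (Set.Ico (a i) (b i))

namespace IntervalLabelled

variable {V ι : Type*} {N : V → Set ι} {a b c : ι → ℤ} {S T : Set V}

theorem empty (a : ι → ℤ) : IntervalLabelled N a ∅ a :=
  ⟨le_rfl, fun _ _ => 0, by simp, by simp⟩

theorem union (h₁ : IntervalLabelled N a S b) (h₂ : IntervalLabelled N b T c)
    (hST : Disjoint S T) : IntervalLabelled N a (S ∪ T) c := by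
  classical
  obtain ⟨hab, φ, hφ, hφ'⟩ := h₁
  obtain ⟨hbc, ψ, hψ, hψ'⟩ := h₂
  have hT {y : V} (hy : y ∈ T) : y ∉ S := fun h => Set.disjoint_left.1 hST h hy
  refine ⟨hab.trans hbc, fun y => if y ∈ S then φ y else ψ y, ?_, fun i => ?_⟩
  · rintro y (hy | hy)
    · simpa [hy] using hφ y hy
    · simpa [hT hy] using hψ y hy
  · have e₁ : Set.BijOn (fun y => (if y ∈ S then φ y else ψ y) i) {y ∈ S | i ∈ N y}
        (Set.Ico (a i) (b i)) :=
      (hφ' i).congr fun y hy => by simp [hy.1]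
    have e₂ : Set.BijOn (fun y => (if y ∈ S then φ y else ψ y) i) {y ∈ T | i ∈ N y}
        (Set.Ico (b i) (c i)) :=
      (hψ' i).congr fun y hy => by simp [hT hy.1]
    have key := e₁.union e₂ ((Set.injOn_union (Set.disjoint_left.2 fun y h h' =>
      hT h'.1 h.1)).2 ⟨e₁.injOn, e₂.injOn, fun y hy z hz => by
        have h₁ := (e₁.mapsTo hy).2
        have h₂ := (e₂.mapsTo hz).1
        exact (h₁.trans_le h₂).ne⟩)
    rw [Set.Ico_union_Ico_eq_Ico (hab i) (hbc i)] at key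
    convert key using 1
    ext y
    simp only [Set.mem_union, Set.mem_ofPred_eq]
    tauto

theorem singleton {y : V} (hin : ∀ i ∈ N y, b i = a i + 1) (hout : ∀ i ∉ N y, b i = a i)
    (h : ∃ l u, Set.BijOn a (N y) (Set.Ico l u)) : IntervalLabelled N a {y} b := by
  refine ⟨fun i => ?_, fun _ => a, by simpa using h, fun i => ?_⟩
  · by_cases hi : i ∈ N y
    · exact (hin i hi).symm ▸ (lt_add_one (a i)).le
    · exact (hout i hi).ge
  · by_cases hi : i ∈ N y
    · have hset : {z ∈ ({y} : Set V) | i ∈ N z} = {y} := by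
        ext z; simp only [Set.mem_ofPred_eq, Set.mem_singleton_iff]
        exact ⟨fun h => h.1, fun h => ⟨h, h ▸ hi⟩⟩
      have hico : Set.Ico (a i) (b i) = {a i} := by
        ext z; have := hin i hi; simp only [Set.mem_Ico, Set.mem_singleton_iff]; omega
      rw [hset, hico, Set.bijOn_singleton]
    · have hset : {z ∈ ({y} : Set V) | i ∈ N z} = ∅ := by
        ext z; simp only [Set.mem_ofPred_eq, Set.mem_singleton_iff, Set.mem_empty_iff_false,
          iff_false]
        rintro ⟨rfl, h'⟩; exact hi h'
      rw [hset, hout i hi, Set.Ico_self]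
      exact Set.bijOn_empty _

theorem exists_up {P : (ι → ℤ) → Prop} (S : Finset V)
    (hstep : ∀ y ∈ S, ∀ a, P a → ∃ b, P b ∧ IntervalLabelled N a {y} b) {a : ι → ℤ} (ha : P a) :
    ∃ b, P b ∧ IntervalLabelled N a S b := by
  classical
  induction S using Finset.induction_on with
  | empty => exact ⟨a, ha, by simpa using empty a⟩
  | insert y S hy ih =>
    obtain ⟨b, hb, hab⟩ := ih fun z hz => hstep z (Finset.mem_insert_of_mem hz)
    obtain ⟨c, hc, hbc⟩ := hstep y (Finset.mem_insert_self _ _) b hb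
    refine ⟨c, hc, ?_⟩
    have := hab.union hbc (by simpa using hy)
    rwa [Set.union_singleton, ← Finset.coe_insert] at this

theorem exists_down {P : (ι → ℤ) → Prop} (S : Finset V)
    (hstep : ∀ y ∈ S, ∀ b, P b → ∃ a, P a ∧ IntervalLabelled N a {y} b) {b : ι → ℤ} (hb : P b) :
    ∃ a, P a ∧ IntervalLabelled N a S b := by
  classical
  induction S using Finset.induction_on with
  | empty => exact ⟨b, hb, by simpa using empty b⟩
  | insert y S hy ih =>
    obtain ⟨a, ha, hab⟩ := ih fun z hz => hstep z (Finset.mem_insert_of_mem hz)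
    obtain ⟨c, hc, hca⟩ := hstep y (Finset.mem_insert_self _ _) a ha
    refine ⟨c, hc, ?_⟩
    have := hca.union hab (by simpa using hy)
    rwa [Set.singleton_union, ← Finset.coe_insert] at this

theorem exists_singleton_of_subsingleton {y : V} (hy : (N y).Subsingleton) (a : ι → ℤ) :
    ∃ b, IntervalLabelled N a {y} b := by
  classical
  refine ⟨fun i => if i ∈ N y then a i + 1 else a i, singleton (by simp +contextual)
    (by simp +contextual) ?_⟩
  obtain h | ⟨i, h⟩ := hy.eq_empty_or_singleton
  · exact ⟨0, 0, by simp [h]⟩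
  · refine ⟨a i, a i + 1, ?_⟩
    have hico : Set.Ico (a i) (a i + 1) = {a i} := by
      ext z; simp only [Set.mem_Ico, Set.mem_singleton_iff]; omega
    rw [h, hico, Set.bijOn_singleton]

theorem singleton_pair {y : V} {i j : ι} (hN : N y = {i, j}) (hij : a j = a i + 1)
    (hi : b i = a i + 1) (hj : b j = a j + 1) (hout : ∀ k, k ≠ i → k ≠ j → b k = a k) :
    IntervalLabelled N a {y} b := by
  refine singleton
    (by rw [hN]; rintro l (rfl | rfl); exacts [hi, hj])
    (fun l hl => by simp only [hN, Set.mem_insert_iff, Set.mem_singleton_iff, not_or] at hl;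
                    exact hout l hl.1 hl.2) ⟨a i, a i + 2, ?_⟩
  rw [hN]
  refine ⟨?_, ?_, ?_⟩
  · rintro k (rfl | rfl) <;> simp only [Set.mem_Ico] <;> omega
  · rintro k (rfl | rfl) l (rfl | rfl) h <;> first | rfl | omega
  · rintro z ⟨h₁, h₂⟩
    obtain h | h : z = a i ∨ z = a j := by omega
    · exact ⟨i, by simp, h.symm⟩
    · exact ⟨j, by simp, h.symm⟩

theorem singleton_triple {y : V} {i j k : ι} (hN : N y = {i, j, k}) (hij : a j = a i + 1)
    (hjk : a k = a j + 1) (hi : b i = a i + 1) (hj : b j = a j + 1) (hk : b k = a k + 1)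
    (hout : ∀ l, l ≠ i → l ≠ j → l ≠ k → b l = a l) :
    IntervalLabelled N a {y} b := by
  refine singleton
    (by rw [hN]; rintro l (rfl | rfl | rfl); exacts [hi, hj, hk])
    (fun l hl => by simp only [hN, Set.mem_insert_iff, Set.mem_singleton_iff, not_or] at hl;
                    exact hout l hl.1 hl.2.1 hl.2.2) ⟨a i, a i + 3, ?_⟩
  rw [hN]
  refine ⟨?_, ?_, ?_⟩
  · rintro l (rfl | rfl | rfl) <;> simp only [Set.mem_Ico] <;> omega
  · rintro l (rfl | rfl | rfl) m (rfl | rfl | rfl) h <;> first | rfl | omega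
  · rintro z ⟨h₁, h₂⟩
    obtain h | h | h : z = a i ∨ z = a j ∨ z = a k := by omega
    · exact ⟨i, by simp, h.symm⟩
    · exact ⟨j, by simp, h.symm⟩
    · exact ⟨k, by simp, h.symm⟩

/-- Equally many vertices of each of the three pair types advance a staircase to a staircase:
each six-cycle advances every interval by two. -/
theorem exists_up_of_card_eq [DecidableEq V] {i j k : ι} (hij : i ≠ j) (hik : i ≠ k) (hjk : j ≠ k)
    {A B C : Finset V} (hA : ∀ y ∈ A, N y = {i, j}) (hB : ∀ y ∈ B, N y = {i, k})
    (hC : ∀ y ∈ C, N y = {j, k}) (hAB : A.card = B.card) (hCB : C.card = B.card)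
    (hdAB : Disjoint A B) (hdAC : Disjoint A C) (hdBC : Disjoint B C)
    {a : ι → ℤ} (ha : a j = a i + 1 ∧ a k = a j + 1) :
    ∃ b, (b j = b i + 1 ∧ b k = b j + 1) ∧
      IntervalLabelled N a ((A : Set V) ∪ B ∪ C) b := by
  classical
  induction B using Finset.induction_on generalizing A C a with
  | empty =>
    obtain rfl : A = ∅ := by simpa using hAB
    obtain rfl : C = ∅ := by simpa using hCB
    exact ⟨a, ha, by simpa using empty a⟩
  | insert q B hq ih =>
    rw [Finset.card_insert_of_notMem hq] at hAB hCB
    obtain ⟨p, A, hp, rfl, hA'⟩ := Finset.card_eq_succ.1 hAB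
    obtain ⟨r, C, hr, rfl, hC'⟩ := Finset.card_eq_succ.1 hCB
    simp only [Finset.disjoint_insert_left, Finset.disjoint_insert_right, Finset.mem_insert,
      not_or] at hdAB hdAC hdBC
    obtain ⟨b, ⟨hb₁, hb₂⟩, hab⟩ := ih (A := A) (C := C)
      (fun y hy => hA y (Finset.mem_insert_of_mem hy))
      (fun y hy => hB y (Finset.mem_insert_of_mem hy))
      (fun y hy => hC y (Finset.mem_insert_of_mem hy)) hA' hC' (by tauto) (by tauto) (by tauto) ha
    let b₁ : ι → ℤ := fun l => if l = i ∨ l = j then b l + 1 else b l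
    let b₂ : ι → ℤ := fun l => if l = i ∨ l = k then b₁ l + 1 else b₁ l
    let b₃ : ι → ℤ := fun l => if l = j ∨ l = k then b₂ l + 1 else b₂ l
    have s₁ : IntervalLabelled N b {p} b₁ :=
      singleton_pair (hA p (by simp)) hb₁ (by simp [b₁]) (by simp [b₁])
        (by simp +contextual [b₁])
    have s₂ : IntervalLabelled N b₁ {q} b₂ :=
      singleton_pair (hB q (by simp)) (by simp [b₁, hik.symm, hjk.symm]; omega)
        (by simp [b₂]) (by simp [b₂]) (by simp +contextual [b₂])
    have s₃ : IntervalLabelled N b₂ {r} b₃ :=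
      singleton_pair (hC r (by simp)) (by simp [b₁, b₂, hij.symm, hik.symm, hjk, hjk.symm]; omega)
        (by simp [b₃]) (by simp [b₃]) (by simp +contextual [b₃])
    refine ⟨b₃, ?_, ?_⟩
    · simp [b₁, b₂, b₃, hij, hij.symm, hik, hik.symm, hjk, hjk.symm]
      omega
    · have hpq : p ≠ q := by tauto
      have hpr : p ≠ r := by tauto
      have hqr : q ≠ r := by tauto
      have := hab.union (s₁.union (s₂.union s₃ (by simpa using hqr)) (by simp [hpq, hpr]))
        (by simp; tauto)
      convert this using 1
      ext z
      simp
      tauto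

theorem exists_of_card_le [Fintype V] [DecidableEq V] [DecidableEq (Set ι)] {i j k : ι}
    (hij : i ≠ j) (hik : i ≠ k) (hjk : j ≠ k) (hall : ∀ l, l = i ∨ l = j ∨ l = k)
    (h₁ : (Finset.univ.filter fun y => N y = {i, k}).card ≤
      (Finset.univ.filter fun y => N y = {i, j}).card)
    (h₂ : (Finset.univ.filter fun y => N y = {i, k}).card ≤
      (Finset.univ.filter fun y => N y = {j, k}).card) :
    ∃ a b, IntervalLabelled N a Set.univ b := by
  classical
  set B := Finset.univ.filter fun y => N y = {i, k} with hBdef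
  obtain ⟨A, hAs, hA⟩ := Finset.exists_subset_card_eq h₁
  obtain ⟨C, hCs, hC⟩ := Finset.exists_subset_card_eq h₂
  have hNA (y) (hy : y ∈ A) : N y = {i, j} := by simpa using hAs hy
  have hNC (y) (hy : y ∈ C) : N y = {j, k} := by simpa using hCs hy
  have hNB (y) (hy : y ∈ B) : N y = {i, k} := by simpa [hBdef] using hy
  have nAB : ({i, j} : Set ι) ≠ {i, k} := fun h => by
    have : j ∈ ({i, k} : Set ι) := h ▸ (by simp)
    simp [hij.symm, hjk] at this
  have nAC : ({i, j} : Set ι) ≠ {j, k} := fun h => by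
    have : i ∈ ({j, k} : Set ι) := h ▸ (by simp)
    simp [hij, hik] at this
  have nBC : ({i, k} : Set ι) ≠ {j, k} := fun h => by
    have : i ∈ ({j, k} : Set ι) := h ▸ (by simp)
    simp [hij, hik] at this
  have nAT : ({i, j} : Set ι) ≠ {i, j, k} := fun h => by
    have : k ∈ ({i, j} : Set ι) := h ▸ (by simp)
    simp [hik.symm, hjk.symm] at this
  have nBT : ({i, k} : Set ι) ≠ {i, j, k} := fun h => by
    have : j ∈ ({i, k} : Set ι) := h ▸ (by simp)
    simp [hij.symm, hjk] at this
  have nCT : ({j, k} : Set ι) ≠ {i, j, k} := fun h => by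
    have : i ∈ ({j, k} : Set ι) := h ▸ (by simp)
    simp [hij, hik] at this
  set A' := (Finset.univ.filter fun y => N y = {i, j}) \ A with hA'
  set C' := (Finset.univ.filter fun y => N y = {j, k}) \ C with hC'
  set T := Finset.univ.filter fun y => N y = {i, j, k} with hT
  set U := Finset.univ.filter fun y => (N y).Subsingleton with hU
  have hNA' (y) (hy : y ∈ A') : N y = {i, j} := by simp [hA'] at hy; exact hy.1
  have hNC' (y) (hy : y ∈ C') : N y = {j, k} := by simp [hC'] at hy; exact hy.1
  have hNT (y) (hy : y ∈ T) : N y = {i, j, k} := by simpa [hT] using hy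
  have hNU (y) (hy : y ∈ U) : (N y).Subsingleton := by simpa [hU] using hy
  obtain ⟨b, hb, hcore⟩ := exists_up_of_card_eq (N := N) hij hik hjk hNA hNB hNC hA hC
    (Finset.disjoint_left.2 fun y h h' => nAB (by rw [← hNA y h, hNB y h']))
    (Finset.disjoint_left.2 fun y h h' => nAC (by rw [← hNA y h, hNC y h']))
    (Finset.disjoint_left.2 fun y h h' => nBC (by rw [← hNB y h, hNC y h']))
    (a := fun l => if l = i then 0 else if l = j then 1 else 2)
    (by simp [hij.symm, hik.symm, hjk.symm])
  obtain ⟨a, -, hbottom⟩ := exists_down (N := N) (P := fun b => b k = b j + 1) C'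
    (fun y hy b hb => by
      refine ⟨fun l => if l = i then b l else b l - 1, by simp [hij.symm, hik.symm, hb],
        singleton_pair (hNC' y hy) ?_ ?_ ?_ ?_⟩
      · simp [hij.symm, hik.symm, hb]
      · simp [hij.symm]
      · simp [hik.symm]
      · intro l hl hl'
        have : l = i := by have := hall l; tauto
        simp [this])
    (b := fun l => if l = i then 0 else if l = j then 1 else 2)
    (by simp [hij.symm, hik.symm, hjk.symm])
  obtain ⟨d, hd, htriple⟩ := exists_up (N := N) (P := fun b => b j = b i + 1 ∧ b k = b j + 1) T
    (fun y hy b hb => by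
      refine ⟨fun l => b l + 1, by simp [hb], singleton_triple (hNT y hy) hb.1 hb.2 rfl rfl rfl ?_⟩
      intro l h₁ h₂ h₃
      have := hall l
      tauto) hb
  obtain ⟨e, -, htop⟩ := exists_up (N := N) (P := fun b => b j = b i + 1) A'
    (fun y hy b hb => by
      refine ⟨fun l => if l = k then b l else b l + 1, by simp [hik, hjk, hb],
        singleton_pair (hNA' y hy) hb ?_ ?_ ?_⟩
      · simp [hik]
      · simp [hjk]
      · intro l hl hl'
        have : l = k := by have := hall l; tauto
        simp [this]) hd.1
  obtain ⟨f, -, hpend⟩ := exists_up (N := N) (P := fun _ => True) U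
    (fun y hy b _ => by
      obtain ⟨c, hc⟩ := exists_singleton_of_subsingleton (hNU y hy) b
      exact ⟨c, trivial, hc⟩) (a := e) trivial
  have nsub {x y : ι} {s : Set ι} (hxy : x ≠ y) (hx : x ∈ s) (hy : y ∈ s) : ¬ s.Subsingleton :=
    fun h => hxy (h hx hy)
  refine ⟨a, f, ?_⟩
  have := (((hbottom.union hcore ?_).union htriple ?_).union htop ?_).union hpend ?_
  · convert this using 1
    symm
    rw [Set.eq_univ_iff_forall]
    intro y
    simp only [Set.mem_union, Finset.mem_coe, hC', hBdef, hA', hT, hU, Finset.mem_sdiff,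
      Finset.mem_filter, Finset.mem_univ, true_and]
    have : N y = {i, j} ∨ N y = {i, k} ∨ N y = {j, k} ∨ N y = {i, j, k} ∨ (N y).Subsingleton := by
      have key (s : Set ι) : s = {l | (l = i ∧ i ∈ s) ∨ (l = j ∧ j ∈ s) ∨ (l = k ∧ k ∈ s)} := by
        ext l
        simp only [Set.mem_ofPred_eq]
        constructor
        · intro hl
          rcases hall l with rfl | rfl | rfl <;> simp [hl]
        · rintro (⟨rfl, h⟩ | ⟨rfl, h⟩ | ⟨rfl, h⟩) <;> exact h
      rw [key (N y)]
      by_cases hi : i ∈ N y <;> by_cases hj : j ∈ N y <;> by_cases hk : k ∈ N y <;>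
        simp only [hi, hj, hk, and_true, and_false, or_false, false_or]
      · exact .inr (.inr (.inr (.inl rfl)))
      · exact .inl rfl
      · exact .inr (.inl rfl)
      · exact .inr (.inr (.inr (.inr (Set.subsingleton_singleton))))
      · exact .inr (.inr (.inl rfl))
      · exact .inr (.inr (.inr (.inr (Set.subsingleton_singleton))))
      · exact .inr (.inr (.inr (.inr (Set.subsingleton_singleton))))
      · exact .inr (.inr (.inr (.inr (Set.subsingleton_empty))))
    tauto
  · rw [Set.disjoint_left]
    rintro y hy ((h | h) | h)
    · exact nAC (by rw [← hNA y h, hNC' y hy])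
    · exact nBC (by rw [← hNB y h, hNC' y hy])
    · exact (Finset.mem_sdiff.1 hy).2 h
  · rw [Set.disjoint_right]
    rintro y hy (h | (h | h) | h)
    · exact nCT (by rw [← hNT y hy, hNC' y h])
    · exact nAT (by rw [← hNT y hy, hNA y h])
    · exact nBT (by rw [← hNT y hy, hNB y h])
    · exact nCT (by rw [← hNT y hy, hNC y h])
  · rw [Set.disjoint_right]
    rintro y hy ((h | (h | h) | h) | h)
    · exact nAC (by rw [← hNA' y hy, hNC' y h])
    · exact (Finset.mem_sdiff.1 hy).2 h
    · exact nAB (by rw [← hNA' y hy, hNB y h])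
    · exact nAC (by rw [← hNA' y hy, hNC y h])
    · exact nAT (by rw [← hNA' y hy, hNT y h])
  · rw [Set.disjoint_right]
    rintro y hy (((h | (h | h) | h) | h) | h)
    · exact nsub hjk (by simp [hNC' y h]) (by simp [hNC' y h]) (hNU y hy)
    · exact nsub hij (by simp [hNA y h]) (by simp [hNA y h]) (hNU y hy)
    · exact nsub hik (by simp [hNB y h]) (by simp [hNB y h]) (hNU y hy)
    · exact nsub hjk (by simp [hNC y h]) (by simp [hNC y h]) (hNU y hy)
    · exact nsub hij (by simp [hNT y h]) (by simp [hNT y h]) (hNU y hy)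
    · exact nsub hij (by simp [hNA' y h]) (by simp [hNA' y h]) (hNU y hy)

theorem exists_fin_three [Fintype V] (N : V → Set (Fin 3)) :
    ∃ a b, IntervalLabelled N a Set.univ b := by
  classical
  let n (i j : Fin 3) : ℕ := (Finset.univ.filter fun y => N y = {i, j}).card
  have hn (i j : Fin 3) : n i j = n j i := by simp only [n, Set.pair_comm]
  obtain ⟨h₁, h₂⟩ | ⟨h₁, h₂⟩ | ⟨h₁, h₂⟩ :
      (n 0 2 ≤ n 0 1 ∧ n 0 2 ≤ n 1 2) ∨ (n 0 1 ≤ n 0 2 ∧ n 0 1 ≤ n 2 1) ∨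
        (n 1 2 ≤ n 1 0 ∧ n 1 2 ≤ n 0 2) := by
    have := hn 2 1
    have := hn 1 0
    omega
  · exact exists_of_card_le (by decide) (by decide) (by decide) (by decide) h₁ h₂
  · exact exists_of_card_le (by decide) (by decide) (by decide) (by decide) h₁ h₂
  · exact exists_of_card_le (by decide) (by decide) (by decide) (by decide) h₁ h₂

end IntervalLabelled

theorem IsBipartition.symm {V : Type*} {G : SimpleGraph V} {X Y : Set V}
    (h : IsBipartition G X Y) : IsBipartition G Y X :=
  ⟨h.1.symm, by rw [Set.union_comm, h.2.1], fun u v huv => (h.2.2 u v huv).symm⟩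

theorem IsBipartition.intervalColorable_of_ncard_le_three {V : Type*} [Fintype V]
    {G : SimpleGraph V} {X Y : Set V} (hbip : IsBipartition G X Y) (hX : X.ncard ≤ 3)
    (hedge : G.edgeSet.Nonempty) : IntervalColorable G := by
  classical
  obtain ⟨hdisj, -, hadj⟩ := hbip
  obtain ⟨g⟩ : Nonempty (X ↪ Fin 3) := Function.Embedding.nonempty_of_card_le (by
    rw [← Nat.card_eq_fintype_card, Nat.card_coe_set_eq, Fintype.card_fin]; exact hX)
  let N (y : V) : Set (Fin 3) := {i | ∃ x : X, g x = i ∧ G.Adj x y}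
  have hN (x : X) (y : V) : g x ∈ N y ↔ G.Adj x y := by
    refine ⟨?_, fun h => ⟨x, rfl, h⟩⟩
    rintro ⟨x', hx', h⟩
    exact g.injective hx' ▸ h
  obtain ⟨a, b, -, φ, hφ, hφ'⟩ := IntervalLabelled.exists_fin_three N
  have hends (e : G.edgeSet) : ∃ (x : X) (y : V), y ∈ Y ∧ (e : Sym2 V) = s((x : V), y) := by
    obtain ⟨e, he⟩ := e
    induction e with
    | h u v =>
      rcases hadj u v he with ⟨hu, hv⟩ | ⟨hu, hv⟩
      · exact ⟨⟨u, hu⟩, v, hv, rfl⟩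
      · exact ⟨⟨v, hv⟩, u, hu, Sym2.eq_swap⟩
  choose p q hq hpq using hends
  have hXY {v : V} (h : v ∈ X) : v ∉ Y := fun h' => Set.disjoint_left.1 hdisj h h'
  have hpqN (e : G.edgeSet) : g (p e) ∈ N (q e) := by
    rw [hN, ← SimpleGraph.mem_edgeSet, ← hpq]; exact e.2
  have hedge_of {x : X} {y : V} (h : G.Adj x y) :
      ∃ e : G.edgeSet, (e : Sym2 V) = s((x : V), y) ∧ p e = x ∧ q e = y := by
    refine ⟨⟨s((x : V), y), h⟩, rfl, ?_⟩
    have hy : y ∈ Y := by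
      rcases hadj _ _ h with h | h
      · exact h.2
      · exact absurd h.1 (hXY x.2)
    have := hpq ⟨s((x : V), y), h⟩
    rcases Sym2.eq_iff.1 this with ⟨h₁, h₂⟩ | ⟨h₁, h₂⟩
    · exact ⟨Subtype.ext h₁.symm, h₂.symm⟩
    · exact absurd hy (h₂ ▸ hXY (p _).2)
  have hext {e e' : G.edgeSet} (h₁ : p e = p e') (h₂ : q e = q e') : e = e' :=
    Subtype.ext (by rw [hpq e, hpq e', h₁, h₂])
  have hinc {v : V} {e : G.edgeSet} (h : v ∈ (e : Sym2 V)) : v = p e ∨ v = q e := by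
    rwa [hpq, Sym2.mem_iff] at h
  have hincX {x : X} {e : G.edgeSet} (h : (x : V) ∈ (e : Sym2 V)) : p e = x := by
    rcases hinc h with h | h
    · exact Subtype.ext h.symm
    · exact absurd (h ▸ hq e) (hXY x.2)
  have hincY {v : V} (hv : v ∉ X) {e : G.edgeSet} (h : v ∈ (e : Sym2 V)) : q e = v := by
    rcases hinc h with h | h
    · exact absurd (h ▸ (p e).2) hv
    · exact h.symm
  refine intervalColorable_of_int_coloring hedge (fun e => φ (q e) (g (p e))) ?_ ?_
  · intro v e he e' he' h
    dsimp only at h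
    by_cases hv : v ∈ X
    · have h₁ : p e = ⟨v, hv⟩ := hincX he
      have h₂ : p e' = ⟨v, hv⟩ := hincX he'
      refine hext (h₁.trans h₂.symm) ((hφ' (g (p e))).injOn ⟨trivial, hpqN e⟩ ⟨trivial, ?_⟩ ?_)
      · rw [h₁, ← h₂]; exact hpqN e'
      · rw [h, h₁, h₂]
    · have h₁ := hincY hv he
      have h₂ := hincY hv he'
      obtain ⟨l, u, hb⟩ := hφ v trivial
      refine hext (g.injective (hb.injOn ?_ ?_ ?_)) (h₁.trans h₂.symm)
      · rw [← h₁]; exact hpqN e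
      · rw [← h₂]; exact hpqN e'
      · rw [h₁, h₂] at h; exact h
  · intro v
    by_cases hv : v ∈ X
    · have : (fun e => φ (q e) (g (p e))) '' {e | v ∈ (e : Sym2 V)} =
          Set.Ico (a (g ⟨v, hv⟩)) (b (g ⟨v, hv⟩)) := by
        rw [← (hφ' (g ⟨v, hv⟩)).image_eq]
        ext z
        constructor
        · rintro ⟨e, he, rfl⟩
          have h₁ : p e = ⟨v, hv⟩ := hincX he
          exact ⟨q e, ⟨trivial, h₁ ▸ hpqN e⟩, by simp only [h₁]⟩
        · rintro ⟨y, ⟨-, hy⟩, rfl⟩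
          obtain ⟨e, he, h₁, h₂⟩ := hedge_of ((hN _ _).1 hy)
          exact ⟨e, by simp [he], by simp only [h₁, h₂]⟩
      rw [this]
      exact Set.ordConnected_Ico
    · obtain ⟨l, u, hb⟩ := hφ v trivial
      have : (fun e => φ (q e) (g (p e))) '' {e | v ∈ (e : Sym2 V)} = Set.Ico l u := by
        rw [← hb.image_eq]
        ext z
        constructor
        · rintro ⟨e, he, rfl⟩
          have h₁ := hincY hv he
          exact ⟨g (p e), h₁ ▸ hpqN e, by simp only [h₁]⟩
        · rintro ⟨_, ⟨x, rfl, hx⟩, rfl⟩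
          obtain ⟨e, he, h₁, h₂⟩ := hedge_of hx
          exact ⟨e, by simp [he], by simp only [h₁, h₂]⟩
      rw [this]
      exact Set.ordConnected_Ico

theorem stmt_4 {V : Type*} [Fintype V] (G : SimpleGraph V) (X Y : Set V)
    (hbip : IsBipartition G X Y) (hsmall : min X.ncard Y.ncard ≤ 3)
    (hedge : G.edgeSet.Nonempty) :
    IntervalColorable G := by
  rcases min_le_iff.1 hsmall with h | h
  · exact hbip.intervalColorable_of_ncard_le_three h hedge
  · exact hbip.symm.intervalColorable_of_ncard_le_three h hedge
end

section
/- There exists a bipartite simple graph on 19 vertices that is not interval colorable, i.e., that admits no interval t-coloring for any positive integer t. -/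
/-- The color of the edge `uv` under `c`, extended by `0` to non-adjacent pairs. -/
noncomputable def pairColor {V : Type*} {G : SimpleGraph V} (c : G.edgeSet → ℕ) (u v : V) : ℕ :=
  open Classical in if h : G.Adj u v then c ⟨s(u, v), h⟩ else 0

theorem pairColor_of_adj {V : Type*} {G : SimpleGraph V} (c : G.edgeSet → ℕ) {u v : V}
    (h : G.Adj u v) : pairColor c u v = c ⟨s(u, v), h⟩ := dif_pos h

theorem pairColor_comm {V : Type*} {G : SimpleGraph V} (c : G.edgeSet → ℕ) (u v : V) :
    pairColor c u v = pairColor c v u := by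
  by_cases h : G.Adj u v
  · rw [pairColor_of_adj c h, pairColor_of_adj c h.symm]
    congr 2
    exact Sym2.eq_swap
  · rw [pairColor, pairColor, dif_neg h, dif_neg fun h' => h h'.symm]

namespace IsIntervalColoring

variable {V : Type*} {G : SimpleGraph V} {t : ℕ} {c : G.edgeSet → ℕ}

/-- The colors of two edges at a vertex differ by less than its degree. -/
theorem pairColor_lt_add_degree (hc : IsIntervalColoring G t c) {v u w : V}
    [Fintype (G.neighborSet v)] (hu : G.Adj v u) (hw : G.Adj v w) :
    pairColor c v w < pairColor c v u + G.degree v := by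
  have hsub : Finset.Icc (pairColor c v u) (pairColor c v w) ⊆
      (G.neighborFinset v).image (pairColor c v) := by
    intro k hk
    rw [Finset.mem_Icc] at hk
    obtain ⟨⟨e, he⟩, hve, rfl⟩ := hc.2.2.2 v _ _ k
      ⟨⟨s(v, u), hu⟩, Sym2.mem_mk_left v u, (pairColor_of_adj c hu).symm⟩
      ⟨⟨s(v, w), hw⟩, Sym2.mem_mk_left v w, (pairColor_of_adj c hw).symm⟩ hk.1 hk.2
    obtain ⟨x, rfl⟩ := hve
    exact Finset.mem_image.2 ⟨x, (G.mem_neighborFinset v x).2 he, pairColor_of_adj c he⟩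
  have hcard := (Finset.card_le_card hsub).trans Finset.card_image_le
  rw [Nat.card_Icc, G.card_neighborFinset_eq_degree] at hcard
  omega

theorem injOn_pairColor (hc : IsIntervalColoring G t c) (v : V) :
    Set.InjOn (pairColor c v) {w | G.Adj v w} := by
  intro u hu w hw huw
  by_contra hne
  rw [pairColor_of_adj c hu, pairColor_of_adj c hw] at huw
  refine hc.2.1 _ _ ?_ ⟨v, Sym2.mem_mk_left v u, Sym2.mem_mk_left v w⟩ huw
  exact fun h => hne (Sym2.congr_right.1 (Subtype.ext_iff.1 h))

/-- The extreme colors at a non-isolated vertex differ by at least its degree minus one. -/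
theorem exists_degree_add_le (hc : IsIntervalColoring G t c) {v : V}
    [Fintype (G.neighborSet v)] (hv : 0 < G.degree v) :
    ∃ u w, G.Adj v u ∧ G.Adj v w ∧ pairColor c v u + G.degree v ≤ pairColor c v w + 1 := by
  have hne : (G.neighborFinset v).Nonempty := by
    rwa [← Finset.card_pos, G.card_neighborFinset_eq_degree]
  obtain ⟨u, hu, hmin⟩ := Finset.exists_min_image _ (pairColor c v) hne
  obtain ⟨w, hw, hmax⟩ := Finset.exists_max_image _ (pairColor c v) hne
  have hcard := Finset.card_le_card_of_injOn (t := Finset.Icc (pairColor c v u) (pairColor c v w))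
    (pairColor c v) (fun x hx => Finset.mem_Icc.2 ⟨hmin x hx, hmax x hx⟩)
    ((hc.injOn_pairColor v).mono fun x hx => (G.mem_neighborFinset v x).1 hx)
  rw [Nat.card_Icc, G.card_neighborFinset_eq_degree] at hcard
  have := hmin w hw
  exact ⟨u, w, (G.mem_neighborFinset v u).1 hu, (G.mem_neighborFinset v w).1 hw, by omega⟩

end IsIntervalColoring

/-- The bipartite graph in which each of the vertices `0, …, 14` is joined to the center `18` and
to two of the three hubs `15, 16, 17`, each pair of hubs being used by five vertices. -/
def rosette : SimpleGraph (Fin 19) where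
  Adj u v := (u.val < 15 ∧ 15 ≤ v.val ∧ u.val % 3 + 15 ≠ v.val) ∨
    (v.val < 15 ∧ 15 ≤ u.val ∧ v.val % 3 + 15 ≠ u.val)
  symm := ⟨fun _ _ h => h.symm⟩
  loopless := ⟨fun _ h => by omega⟩

instance : DecidableRel rosette.Adj := fun u v => by
  unfold rosette
  infer_instance

theorem isBipartite_rosette : IsBipartite rosette := by
  refine ⟨{u | u.val < 15}, {u | 15 ≤ u.val}, ?_, ?_, ?_⟩
  · exact Set.disjoint_left.2 fun u (hu : u.val < 15) (hu' : 15 ≤ u.val) => by omega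
  · exact Set.eq_univ_of_forall fun u => lt_or_ge u.val 15
  · rintro u v (h | h)
    · exact .inl ⟨h.1, h.2.1⟩
    · exact .inr ⟨h.2.1, h.1⟩

theorem rosette_degree_center : rosette.degree 18 = 15 := by decide

theorem rosette_degree_of_adj_center :
    ∀ u, rosette.Adj 18 u → rosette.degree u = 3 := by decide

theorem rosette_exists_common_hub : ∀ u w, rosette.Adj 18 u → rosette.Adj 18 w →
    ∃ h, rosette.Adj h u ∧ rosette.Adj h w ∧ rosette.degree h = 10 := by
  have hdeg : ∀ h : Fin 19, 15 ≤ h.val → h.val < 18 → rosette.degree h = 10 := by decide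
  have hub : ∀ u w, rosette.Adj 18 u → rosette.Adj 18 w →
      ∃ h : Fin 19, rosette.Adj h u ∧ rosette.Adj h w ∧ 15 ≤ h.val ∧ h.val < 18 := by decide
  intro u w hu hw
  obtain ⟨h, h₁, h₂, h₃, h₄⟩ := hub u w hu hw
  exact ⟨h, h₁, h₂, hdeg h h₃ h₄⟩

theorem not_intervalColorable_rosette : ¬ IntervalColorable rosette := by
  rintro ⟨t, -, c, hc⟩
  obtain ⟨u, w, hu, hw, huw⟩ := hc.exists_degree_add_le (v := 18) (by simp [rosette_degree_center])
  obtain ⟨h, hhu, hhw, hh⟩ := rosette_exists_common_hub u w hu hw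
  have h₁ := hc.pairColor_lt_add_degree hu.symm hhu.symm
  have h₂ := hc.pairColor_lt_add_degree hhu hhw
  have h₃ := hc.pairColor_lt_add_degree hhw.symm hw.symm
  rw [rosette_degree_center] at huw
  rw [rosette_degree_of_adj_center u hu, pairColor_comm c u 18, pairColor_comm c u h] at h₁
  rw [rosette_degree_of_adj_center w hw, pairColor_comm c w 18, pairColor_comm c w h] at h₃
  rw [hh] at h₂
  omega

theorem stmt_5 :
    ∃ G : SimpleGraph (Fin 19), IsBipartite G ∧ ¬ IntervalColorable G :=
  ⟨rosette, isBipartite_rosette, not_intervalColorable_rosette⟩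
end

section
/- Let G be a finite simple graph and let v be a vertex of G of degree 1. If the graph G − v obtained by deleting v (and its incident edge) is interval colorable, then G is interval colorable. -/
/-- If every edge of `G` other than a pendant edge `e₀` at `u` comes from a coloured graph, then
giving `e₀` the colour after the largest one at `u` extends the colouring. -/
theorem IntervalColorable.of_pendant_edge {V W : Type*} {G : SimpleGraph V} {H : SimpleGraph W}
    (φ : W ↪ V) (ψ : H.edgeSet ↪ G.edgeSet)
    (hψ : ∀ e x, x ∈ (ψ e : Sym2 V) ↔ ∃ w ∈ (e : Sym2 W), φ w = x)
    (e₀ : G.edgeSet) (u : W) (v : V) (hv : v ∉ Set.range φ) (he₀ : (e₀ : Sym2 V) = s(v, φ u))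
    (hcover : ∀ e, e = e₀ ∨ ∃ e', ψ e' = e) (hH : IntervalColorable H) :
    IntervalColorable G := by
  classical
  obtain ⟨t, ht, c, hrange, hproper, hsurj, hint⟩ := hH
  obtain ⟨M, hMt, hM, hMatt⟩ : ∃ M ≤ t, (∀ e : H.edgeSet, u ∈ (e : Sym2 W) → c e ≤ M) ∧
      (M ≠ 0 → ∃ e : H.edgeSet, u ∈ (e : Sym2 W) ∧ c e = M) :=
    ⟨Nat.findGreatest (fun k => ∃ e : H.edgeSet, u ∈ (e : Sym2 W) ∧ c e = k) t,
      Nat.findGreatest_le t,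
      fun e he => Nat.le_findGreatest (hrange e).2 ⟨e, he, rfl⟩,
      fun h => Nat.findGreatest_of_ne_zero rfl h⟩
  have hmem (e : H.edgeSet) (w : W) : φ w ∈ (ψ e : Sym2 V) ↔ w ∈ (e : Sym2 W) := by
    simp [hψ]
  have hvψ (e : H.edgeSet) : v ∉ (ψ e : Sym2 V) := by
    rw [hψ]
    rintro ⟨w, -, hw⟩
    exact hv ⟨w, hw⟩
  have hve₀ : v ∈ (e₀ : Sym2 V) := by simp [he₀]
  have hue₀ : φ u ∈ (e₀ : Sym2 V) := by simp [he₀]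
  have hcommon (e : H.edgeSet) (x : V) (hx : x ∈ (ψ e : Sym2 V)) (hx₀ : x ∈ (e₀ : Sym2 V)) :
      x = φ u := by
    rw [he₀, Sym2.mem_iff] at hx₀
    exact hx₀.resolve_left fun h => hvψ e (h ▸ hx)
  have hne (e : H.edgeSet) : ψ e ≠ e₀ := fun h => hvψ e (h ▸ hve₀)
  obtain ⟨d, hd, hd₀⟩ : ∃ d : G.edgeSet → ℕ, (∀ e, d (ψ e) = c e) ∧ d e₀ = M + 1 :=
    ⟨Function.extend ψ c fun _ => M + 1, fun e => ψ.injective.extend_apply _ _ _,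
      Function.extend_apply' _ _ _ fun ⟨e, he⟩ => hne e he⟩
  refine ⟨max t (M + 1), by omega, d, ?_, ?_, ?_, ?_⟩
  · intro e
    obtain rfl | ⟨e, rfl⟩ := hcover e
    · omega
    · have := hrange e
      rw [hd]
      omega
  · rintro e₁ e₂ h12 ⟨x, hx₁, hx₂⟩
    obtain rfl | ⟨e₁, rfl⟩ := hcover e₁ <;> obtain rfl | ⟨e₂, rfl⟩ := hcover e₂
    · exact absurd rfl h12
    · obtain rfl := hcommon _ _ hx₂ hx₁
      have := hM e₂ ((hmem _ _).1 hx₂)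
      rw [hd]
      omega
    · obtain rfl := hcommon _ _ hx₁ hx₂
      have := hM e₁ ((hmem _ _).1 hx₁)
      rw [hd]
      omega
    · obtain ⟨w, hw, rfl⟩ := (hψ _ _).1 hx₁
      rw [hd, hd]
      exact hproper _ _ (fun h => h12 (congrArg ψ h)) ⟨w, hw, (hmem _ _).1 hx₂⟩
  · intro k hk₁ hk
    by_cases hkt : k ≤ t
    · obtain ⟨e, he⟩ := hsurj k hk₁ hkt
      exact ⟨ψ e, (hd e).trans he⟩
    · exact ⟨e₀, by omega⟩
  · rintro x _ _ k ⟨e₁, hx₁, rfl⟩ ⟨e₂, hx₂, rfl⟩ hk₁ hk₂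
    have lift_int (w : W) (f₁ f₂ : H.edgeSet) (hf₁ : w ∈ (f₁ : Sym2 W)) (hf₂ : w ∈ (f₂ : Sym2 W))
        (h₁ : c f₁ ≤ k) (h₂ : k ≤ c f₂) : ∃ e : G.edgeSet, φ w ∈ (e : Sym2 V) ∧ d e = k := by
      obtain ⟨e, he, hek⟩ := hint w _ _ k ⟨f₁, hf₁, rfl⟩ ⟨f₂, hf₂, rfl⟩ h₁ h₂
      exact ⟨ψ e, (hmem _ _).2 he, (hd e).trans hek⟩
    obtain rfl | ⟨e₁, rfl⟩ := hcover e₁ <;> obtain rfl | ⟨e₂, rfl⟩ := hcover e₂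
    · exact ⟨_, hx₁, by omega⟩
    · obtain rfl := hcommon _ _ hx₂ hx₁
      have := hM e₂ ((hmem _ _).1 hx₂)
      rw [hd] at hk₂
      omega
    · obtain rfl := hcommon _ _ hx₁ hx₂
      have hu₁ := (hmem _ _).1 hx₁
      rw [hd] at hk₁
      by_cases hkM : k = M + 1
      · exact ⟨_, hue₀, by omega⟩
      · have := hrange e₁
        obtain ⟨f, hf, hfM⟩ := hMatt (by omega)
        exact lift_int u e₁ f hu₁ hf hk₁ (by omega)
    · obtain ⟨w, hw, rfl⟩ := (hψ _ _).1 hx₁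
      rw [hd] at hk₁ hk₂
      exact lift_int w e₁ e₂ hw ((hmem _ _).1 hx₂) hk₁ hk₂

theorem stmt_7 {V : Type*} [Fintype V] (G : SimpleGraph V) (v : V)
    (hdeg : (G.neighborSet v).ncard = 1)
    (hcol : IntervalColorable (G.induce {u : V | u ≠ v})) :
    IntervalColorable G := by
  obtain ⟨u, hu⟩ := Set.ncard_eq_one.1 hdeg
  have hnbr (w : V) : G.Adj v w ↔ w = u := by
    rw [← SimpleGraph.mem_neighborSet, hu, Set.mem_singleton_iff]
  have hvu : G.Adj v u := (hnbr u).2 rfl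
  let ι := SimpleGraph.Embedding.induce (G := G) {w : V | w ≠ v}
  refine hcol.of_pendant_edge (Function.Embedding.subtype _) ι.mapEdgeSet
    (fun e x => Sym2.mem_map) ⟨s(v, u), hvu⟩ ⟨u, hvu.ne'⟩ v ?_ rfl ?_
  · rintro ⟨w, hw⟩
    exact w.2 hw
  · rintro ⟨e, he⟩
    induction e with | _ a b
    rw [SimpleGraph.mem_edgeSet] at he
    by_cases ha : a = v
    · subst ha
      obtain rfl := (hnbr b).1 he
      exact .inl rfl
    by_cases hb : b = v
    · subst hb
      obtain rfl := (hnbr a).1 he.symm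
      exact .inl (Subtype.ext Sym2.eq_swap)
    · exact .inr ⟨⟨s(⟨a, ha⟩, ⟨b, hb⟩), he⟩, rfl⟩
end

section
/- For all positive integers m and n, the complete bipartite graph K_{m,n} is interval colorable. -/
/-- The index of a vertex of `K_{m,n}` within its own part. -/
def partIndex {m n : ℕ} : Fin m ⊕ Fin n → ℕ :=
  Sum.elim Fin.val Fin.val

/-- The coloring of pairs of vertices that gives the edge joining the `i`-th vertex of one part to
the `j`-th vertex of the other the color `i + j + 1`. -/
def indexSumColor {m n : ℕ} : Sym2 (Fin m ⊕ Fin n) → ℕ :=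
  Sym2.lift ⟨fun u v => partIndex u + partIndex v + 1, fun u v => by
    simp only [add_comm (partIndex u)]⟩

@[simp]
lemma indexSumColor_inl_inr {m n : ℕ} (i : Fin m) (j : Fin n) :
    indexSumColor s(Sum.inl i, Sum.inr j) = i + j + 1 := rfl

lemma inl_inr_mem_edgeSet {m n : ℕ} (i : Fin m) (j : Fin n) :
    s(Sum.inl i, Sum.inr j) ∈ (completeBipartiteGraph (Fin m) (Fin n)).edgeSet := by
  simp

lemma exists_eq_inl_inr_of_mem_edgeSet {m n : ℕ} {e : Sym2 (Fin m ⊕ Fin n)}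
    (he : e ∈ (completeBipartiteGraph (Fin m) (Fin n)).edgeSet) :
    ∃ i j, e = s(Sum.inl i, Sum.inr j) := by
  induction e using Sym2.ind with
  | _ u v =>
    rcases u with i | i <;> rcases v with j | j <;> simp at he ⊢

theorem stmt_9 (m n : ℕ) (hm : 0 < m) (hn : 0 < n) :
    IntervalColorable (completeBipartiteGraph (Fin m) (Fin n)) := by
  refine ⟨m + n - 1, by omega, fun e => indexSumColor e.1, ?_, ?_, ?_, ?_⟩
  · rintro ⟨e, he⟩
    obtain ⟨i, j, rfl⟩ := exists_eq_inl_inr_of_mem_edgeSet he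
    simp only [indexSumColor_inl_inr]
    omega
  · rintro ⟨e₁, he₁⟩ ⟨e₂, he₂⟩ hne ⟨v, hv₁, hv₂⟩ hc
    obtain ⟨i₁, j₁, rfl⟩ := exists_eq_inl_inr_of_mem_edgeSet he₁
    obtain ⟨i₂, j₂, rfl⟩ := exists_eq_inl_inr_of_mem_edgeSet he₂
    simp only [indexSumColor_inl_inr] at hc
    have hij : i₁ = i₂ ∨ j₁ = j₂ := by
      rcases v with v | v <;> simp at hv₁ hv₂
      · exact .inl (hv₁.symm.trans hv₂)
      · exact .inr (hv₁.symm.trans hv₂)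
    have hi : i₁ = i₂ := by omega
    have hj : j₁ = j₂ := by omega
    exact hne (by subst hi hj; rfl)
  · intro k hk hkt
    refine ⟨⟨_, inl_inr_mem_edgeSet ⟨min (k - 1) (m - 1), by omega⟩
      ⟨k - 1 - min (k - 1) (m - 1), by omega⟩⟩, ?_⟩
    simp only [indexSumColor_inl_inr]
    omega
  · rintro v _ _ k ⟨⟨e₁, he₁⟩, hv₁, rfl⟩ ⟨⟨e₂, he₂⟩, hv₂, rfl⟩ hk₁ hk₂
    obtain ⟨i₁, j₁, rfl⟩ := exists_eq_inl_inr_of_mem_edgeSet he₁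
    obtain ⟨i₂, j₂, rfl⟩ := exists_eq_inl_inr_of_mem_edgeSet he₂
    simp only [indexSumColor_inl_inr] at hk₁ hk₂
    rcases v with v | v <;> simp at hv₁ hv₂ <;> subst hv₁ hv₂
    · refine ⟨⟨_, inl_inr_mem_edgeSet v ⟨k - 1 - v, by omega⟩⟩, by simp, ?_⟩
      simp only [indexSumColor_inl_inr]
      omega
    · refine ⟨⟨_, inl_inr_mem_edgeSet ⟨k - 1 - v, by omega⟩ v⟩, by simp, ?_⟩
      simp only [indexSumColor_inl_inr]
      omega
end

section
/- Every finite tree with at least one edge is interval colorable. -/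
/-- A symmetric assignment of positive colors to ordered pairs of vertices which, on the edges
of `G`, is an interval coloring whose set of colors is an initial segment of the positive
integers. -/
structure IsIntervalLabeling {V : Type*} (G : SimpleGraph V) (c : V → V → ℕ) : Prop where
  symm : ∀ x y, c x y = c y x
  pos : ∀ x y, G.Adj x y → 1 ≤ c x y
  inj : ∀ x a b, G.Adj x a → G.Adj x b → c x a = c x b → a = b
  interval : ∀ x a b k, G.Adj x a → G.Adj x b → c x a ≤ k → k ≤ c x b → ∃ w, G.Adj x w ∧ c x w = k
  initial : ∀ x y k, G.Adj x y → 1 ≤ k → k ≤ c x y → ∃ a b, G.Adj a b ∧ c a b = k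

/-- An interval labeling extends over a pendant edge `vu`, which receives the color following the
largest one at `u`. -/
theorem IsIntervalLabeling.exists_of_induce_compl_singleton {V : Type*} [Finite V]
    {G : SimpleGraph V} {v u : V} (hv : ∀ w, G.Adj v w ↔ w = u)
    {c : ({v}ᶜ : Set V) → ({v}ᶜ : Set V) → ℕ} (hc : IsIntervalLabeling (G.induce {v}ᶜ) c) :
    ∃ c' : V → V → ℕ, IsIntervalLabeling G c' := by
  classical
  have hvu : G.Adj v u := (hv u).2 rfl
  have huv : u ≠ v := hvu.ne'
  let d : V → V → ℕ := fun x y =>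
    if h : x ≠ v ∧ y ≠ v then c ⟨x, h.1⟩ ⟨y, h.2⟩ else 0
  have hd : ∀ x y (hx : x ≠ v) (hy : y ≠ v), d x y = c ⟨x, hx⟩ ⟨y, hy⟩ := fun x y hx hy =>
    dif_pos ⟨hx, hy⟩
  clear_value d
  have d_symm : ∀ x y, x ≠ v → y ≠ v → d x y = d y x := fun x y hx hy => by
    rw [hd x y hx hy, hd y x hy hx, hc.symm]
  have d_pos : ∀ x y, x ≠ v → y ≠ v → G.Adj x y → 1 ≤ d x y := fun x y hx hy h => by
    rw [hd x y hx hy]; exact hc.pos _ _ h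
  have d_inj : ∀ x a b, x ≠ v → a ≠ v → b ≠ v → G.Adj x a → G.Adj x b → d x a = d x b → a = b :=
    fun x a b hx ha hb hxa hxb h => by
      rw [hd x a hx ha, hd x b hx hb] at h
      exact congrArg Subtype.val (hc.inj ⟨x, hx⟩ ⟨a, ha⟩ ⟨b, hb⟩ hxa hxb h)
  have d_interval : ∀ x a b k, x ≠ v → a ≠ v → b ≠ v → G.Adj x a → G.Adj x b → d x a ≤ k →
      k ≤ d x b → ∃ w, w ≠ v ∧ G.Adj x w ∧ d x w = k := fun x a b k hx ha hb hxa hxb h₁ h₂ => by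
    rw [hd x a hx ha] at h₁
    rw [hd x b hx hb] at h₂
    obtain ⟨w, hw, hk⟩ := hc.interval ⟨x, hx⟩ ⟨a, ha⟩ ⟨b, hb⟩ k hxa hxb h₁ h₂
    exact ⟨w, w.2, hw, (hd x w hx w.2).trans hk⟩
  have d_initial : ∀ x y k, x ≠ v → y ≠ v → G.Adj x y → 1 ≤ k → k ≤ d x y →
      ∃ a b, a ≠ v ∧ b ≠ v ∧ G.Adj a b ∧ d a b = k := fun x y k hx hy hxy h₁ h₂ => by
    rw [hd x y hx hy] at h₂
    obtain ⟨a, b, hab, hk⟩ := hc.initial ⟨x, hx⟩ ⟨y, hy⟩ k hxy h₁ h₂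
    exact ⟨a, b, a.2, b.2, hab, (hd a b a.2 b.2).trans hk⟩
  obtain ⟨m, hm, hm'⟩ : ∃ m, (∀ w, w ≠ v → G.Adj u w → d u w ≤ m) ∧
      (m = 0 ∨ ∃ w, w ≠ v ∧ G.Adj u w ∧ d u w = m) := by
    by_cases h : {w | w ≠ v ∧ G.Adj u w}.Nonempty
    · obtain ⟨w, hw, hmax⟩ := Set.exists_max_image _ (d u) (Set.toFinite _) h
      exact ⟨d u w, fun w' h₁ h₂ => hmax w' ⟨h₁, h₂⟩, .inr ⟨w, hw.1, hw.2, rfl⟩⟩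
    · exact ⟨0, fun w h₁ h₂ => (h ⟨w, h₁, h₂⟩).elim, .inl rfl⟩
  let c' : V → V → ℕ := fun x y => if x = v ∨ y = v then m + 1 else d x y
  have c'_old : ∀ x y, x ≠ v → y ≠ v → c' x y = d x y := fun x y hx hy => by simp [c', hx, hy]
  have c'_left : ∀ y, c' v y = m + 1 := fun y => by simp [c']
  have c'_right : ∀ x, c' x v = m + 1 := fun x => by simp [c']
  clear_value c'
  have hv' : ∀ w, G.Adj w v ↔ w = u := fun w => by rw [G.adj_comm, hv]
  refine ⟨c', ?_, ?_, ?_, ?_, ?_⟩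
  · intro x y
    by_cases hx : x = v
    · rw [hx, c'_left, c'_right]
    by_cases hy : y = v
    · rw [hy, c'_left, c'_right]
    rw [c'_old x y hx hy, c'_old y x hy hx, d_symm x y hx hy]
  · intro x y hxy
    by_cases hx : x = v
    · rw [hx, c'_left]
      omega
    by_cases hy : y = v
    · rw [hy, c'_right]
      omega
    exact (c'_old x y hx hy).symm ▸ d_pos x y hx hy hxy
  · intro x a b hxa hxb h
    by_cases hx : x = v
    · subst hx
      exact ((hv a).1 hxa).trans ((hv b).1 hxb).symm
    by_cases ha : a = v <;> by_cases hb : b = v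
    · rw [ha, hb]
    · subst ha
      obtain rfl := (hv' x).1 hxa
      have := hm b hb hxb
      rw [c'_right, c'_old x b hx hb] at h
      omega
    · subst hb
      obtain rfl := (hv' x).1 hxb
      have := hm a ha hxa
      rw [c'_right, c'_old x a hx ha] at h
      omega
    · rw [c'_old x a hx ha, c'_old x b hx hb] at h
      exact d_inj x a b hx ha hb hxa hxb h
  · intro x a b k hxa hxb h₁ h₂
    by_cases hx : x = v
    · subst hx
      rw [c'_left] at h₁ h₂
      exact ⟨a, hxa, (c'_left a).trans (le_antisymm h₁ h₂)⟩
    by_cases hk : k = c' x b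
    · exact ⟨b, hxb, hk.symm⟩
    by_cases hk' : k = c' x a
    · exact ⟨a, hxa, hk'.symm⟩
    have ha : a ≠ v := by
      rintro rfl
      obtain rfl := (hv' x).1 hxa
      rw [c'_right] at h₁ hk'
      by_cases hb : b = a
      · rw [hb, c'_right] at h₂
        omega
      · have := hm b hb hxb
        rw [c'_old x b hx hb] at h₂
        omega
    rw [c'_old x a hx ha] at h₁
    by_cases hb : b = v
    · subst hb
      obtain rfl := (hv' x).1 hxb
      rw [c'_right] at h₂ hk
      obtain rfl | ⟨w, hw, hxw, rfl⟩ := hm'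
      · have := d_pos x a hx ha hxa
        omega
      · obtain ⟨z, hz, hxz, hzk⟩ := d_interval x a w k hx ha hw hxa hxw h₁ (by omega)
        exact ⟨z, hxz, (c'_old x z hx hz).trans hzk⟩
    · rw [c'_old x b hx hb] at h₂
      obtain ⟨z, hz, hxz, hzk⟩ := d_interval x a b k hx ha hb hxa hxb h₁ h₂
      exact ⟨z, hxz, (c'_old x z hx hz).trans hzk⟩
  · intro x y k hxy h₁ h₂
    by_cases hk : k = m + 1
    · exact ⟨v, u, hvu, (c'_left u).trans hk.symm⟩
    obtain ⟨x', y', hx', hy', hxy', hle⟩ :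
        ∃ x' y', x' ≠ v ∧ y' ≠ v ∧ G.Adj x' y' ∧ k ≤ d x' y' := by
      by_cases h : x = v ∨ y = v
      · have : c' x y = m + 1 := by
          rcases h with rfl | rfl
          · exact c'_left y
          · exact c'_right x
        obtain rfl | ⟨w, hw, hxw, rfl⟩ := hm'
        · omega
        · exact ⟨u, w, huv, hw, hxw, by omega⟩
      · rw [not_or] at h
        exact ⟨x, y, h.1, h.2, hxy, c'_old x y h.1 h.2 ▸ h₂⟩
    obtain ⟨a, b, ha, hb, hab, habk⟩ := d_initial x' y' k hx' hy' hxy' h₁ hle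
    exact ⟨a, b, hab, (c'_old a b ha hb).trans habk⟩

theorem SimpleGraph.IsTree.exists_isIntervalLabeling {V : Type*} [Finite V] {G : SimpleGraph V}
    (hG : G.IsTree) : ∃ c : V → V → ℕ, IsIntervalLabeling G c := by
  classical
  induction hn : Nat.card V generalizing V with
  | zero =>
    have := hG.connected.nonempty
    exact absurd hn Nat.card_pos.ne'
  | succ n ih =>
    have := Fintype.ofFinite V
    cases subsingleton_or_nontrivial V
    · have hadj : ∀ x y, ¬ G.Adj x y := fun x y h => h.ne (Subsingleton.elim x y)
      exact ⟨fun _ _ => 0, fun _ _ => rfl, fun _ _ h => (hadj _ _ h).elim,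
        fun _ _ _ h => (hadj _ _ h).elim, fun _ _ _ _ h => (hadj _ _ h).elim,
        fun _ _ _ h => (hadj _ _ h).elim⟩
    · obtain ⟨v, hv⟩ := hG.exists_vert_degree_one_of_nontrivial
      obtain ⟨u, hu, huniq⟩ := G.degree_eq_one_iff_existsUnique_adj.1 hv
      have htree : (G.induce {v}ᶜ).IsTree :=
        ⟨hG.connected.induce_compl_singleton_of_degree_eq_one hv, hG.isAcyclic.induce _⟩
      obtain ⟨c, hc⟩ := ih htree (by
        rw [Nat.card_coe_set_eq, Set.ncard_compl, hn, Set.ncard_singleton, Nat.add_sub_cancel])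
      exact hc.exists_of_induce_compl_singleton fun w => ⟨huniq w, fun h => h ▸ hu⟩

/-- An interval labeling of a finite graph with an edge induces an interval coloring. -/
theorem IsIntervalLabeling.intervalColorable {V : Type*} [Finite V] {G : SimpleGraph V}
    {c : V → V → ℕ} (hc : IsIntervalLabeling G c) (hG : G.edgeSet.Nonempty) :
    IntervalColorable G := by
  let f : Sym2 V → ℕ := Sym2.lift ⟨c, hc.symm⟩
  obtain ⟨e, he, hmax⟩ := Set.exists_max_image _ f (Set.toFinite _) hG
  have hpos : ∀ e ∈ G.edgeSet, 1 ≤ f e := fun e => e.ind hc.pos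
  refine ⟨f e, hpos e he, fun e' => f e', fun e' => ⟨hpos e' e'.2, hmax e' e'.2⟩, ?_, ?_, ?_⟩
  · rintro ⟨e₁, h₁⟩ ⟨e₂, h₂⟩ hne ⟨v, hv₁, hv₂⟩ h
    obtain ⟨a, rfl⟩ := hv₁
    obtain ⟨b, rfl⟩ := hv₂
    obtain rfl := hc.inj v a b h₁ h₂ h
    exact hne rfl
  · intro k hk hke
    induction e with | _ x y
    obtain ⟨a, b, hab, habk⟩ := hc.initial x y k he hk hke
    exact ⟨⟨s(a, b), hab⟩, habk⟩
  · rintro v k₁ k₂ k ⟨⟨e₁, h₁⟩, ⟨a, rfl⟩, rfl⟩ ⟨⟨e₂, h₂⟩, ⟨b, rfl⟩, rfl⟩ hk₁ hk₂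
    obtain ⟨w, hw, hwk⟩ := hc.interval v a b k h₁ h₂ hk₁ hk₂
    exact ⟨⟨s(v, w), hw⟩, Sym2.mem_mk_left v w, hwk⟩

theorem stmt_10 {V : Type*} [Fintype V] (G : SimpleGraph V)
    (htree : G.IsTree) (hedge : G.edgeSet.Nonempty) :
    IntervalColorable G := by
  obtain ⟨c, hc⟩ := htree.exists_isIntervalLabeling
  exact hc.intervalColorable hedge
end
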